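/- Consider the hyperbolic algebra Λ₀ = ℝe₀ ⊕ ℝe₁, the two-dimensional commutative associative unital ℝ-algebra with unit e₀ and e₁² = e₀. For any continuously differentiable functions φ, ψ : ℝ → ℝ, the function f : Λ₀ → Λ₀ defined by f(x e₀ + y e₁) = [φ(x+y) + ψ(x−y)] e₀ + [φ(x+y) − ψ(x−y)] e₁ is S-differentiable on Λ₀ (in particular, S-differentiable functions on Λ₀ need not be more regular than C¹). -/

import Mathlib

/-- Continuous coordinate functionals for a pair of vectors that is linearly independent and
spanning. -/
theorem exists_continuous_coords_of_pair {E : Type*} [NormedAddCommGroup E] [NormedSpace ℝ E]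
    {a b : E} (hindep : LinearIndependent ℝ ![a, b])
    (hspan : Submodule.span ℝ {a, b} = ⊤) :
    ∃ p q : E →L[ℝ] ℝ, ∀ z, z = p z • a + q z • b := by
  let B : Module.Basis (Fin 2) ℝ E := Module.Basis.mk hindep (by simp [Set.pair_comm b a, hspan])
  have : FiniteDimensional ℝ E := B.finiteDimensional_of_finite
  refine ⟨(B.coord 0).toContinuousLinearMap, (B.coord 1).toContinuousLinearMap, fun z => ?_⟩
  simpa [Fin.sum_univ_two, B] using (B.sum_repr z).symm


/-- hyperbolic analysis: `C¹` S-differentiable functions. Let `Λ` be the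
hyperbolic algebra: a real normed algebra with basis `(1, e₁)` and `e₁² = 1`. For any `C¹`
functions `φ ψ : ℝ → ℝ`, the function `f` defined by
`f (x • 1 + y • e₁) = (φ (x+y) + ψ (x-y)) • 1 + (φ (x+y) - ψ (x-y)) • e₁`
is S-differentiable on all of `Λ`: at every point its derivative is multiplication by an
element of `Λ`. -/
theorem hyperbolic_dAlembert_SDiff
    {Λ : Type*} [NormedRing Λ] [NormedAlgebra ℝ Λ]
    (e₁ : Λ) (hsq : e₁ ^ 2 = 1)
    (hindep : LinearIndependent ℝ ![(1 : Λ), e₁])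
    (hspan : Submodule.span ℝ {(1 : Λ), e₁} = ⊤)
    (φ ψ : ℝ → ℝ) (hφ : ContDiff ℝ 1 φ) (hψ : ContDiff ℝ 1 ψ)
    (f : Λ → Λ)
    (hf : ∀ x y : ℝ, f (x • (1 : Λ) + y • e₁) =
      (φ (x + y) + ψ (x - y)) • (1 : Λ) + (φ (x + y) - ψ (x - y)) • e₁) :
    ∀ z : Λ, DifferentiableAt ℝ f z ∧ ∃ c : Λ, ∀ h : Λ, fderiv ℝ f z h = c * h := by
  obtain ⟨p, q, hpq⟩ := exists_continuous_coords_of_pair hindep hspan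
  have hf_eq : f = fun z => φ ((p + q) z) • (1 + e₁) + ψ ((p - q) z) • (1 - e₁) := by
    funext z
    conv_lhs => rw [hpq z, hf]
    simp only [add_apply, sub_apply]
    module
  intro z
  have hφ' := (hφ.differentiable one_ne_zero ((p + q) z)).hasDerivAt.comp_hasFDerivAt z
    (p + q).hasFDerivAt
  have hψ' := (hψ.differentiable one_ne_zero ((p - q) z)).hasDerivAt.comp_hasFDerivAt z
    (p - q).hasFDerivAt
  have hderiv := (hφ'.smul_const (1 + e₁)).add (hψ'.smul_const (1 - e₁))
  replace hderiv := hderiv.congr_of_eventuallyEq (.of_eq hf_eq)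
  refine ⟨hderiv.differentiableAt,
    deriv φ ((p + q) z) • (1 + e₁) + deriv ψ ((p - q) z) • (1 - e₁), fun h => ?_⟩
  rw [hderiv.fderiv]
  conv_rhs => rw [hpq h]
  rw [sq] at hsq
  simp only [add_apply, sub_apply,
    ContinuousLinearMap.smulRight_apply, smul_apply, smul_eq_mul,
    add_mul, sub_mul, mul_add, smul_mul_assoc, mul_smul_comm, mul_one, one_mul, hsq]
  module
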